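/- arXiv:1612.08699 — 6 statements merged into one kernel-verified Lean document; each statement's English description precedes it below -/
import Mathlib

section
/- Let α₁, α₂, β, γ₁, γ₂ be integrable real random variables on a probability space with α₁·β, α₁·γ₁, α₂·β, α₂·γ₂ integrable. Assume Cov(α₁, β) = 0, Cov(α₁, γ₁) = 0, Cov(α₂, β) = 0, Cov(α₂, γ₂) = 0 (no covariance between treatment and mediator parameters), E[γ₁] = E[γ₂] = 0 (no expected treatment–mediator interaction), E[α₁] ≠ 0, and E[β] ≠ 0. Then for all reals t₁, t₂: E[α₂·(β + γ₂·t₂)] / E[α₁·(β + γ₁·t₁)] = E[α₂] / E[α₁]. -/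
open MeasureTheory

/-- Identification of the first comparative causal mediation estimand:
under no covariance between treatment and mediator parameters and no expected
treatment–mediator interaction, `κ₂(t₂)/κ₁(t₁) = E[α₂]/E[α₁]`. -/
theorem ccm_estimand_one_identification
    {Ω : Type*} [MeasurableSpace Ω] (μ : Measure Ω) [IsProbabilityMeasure μ]
    (α₁ α₂ β γ₁ γ₂ : Ω → ℝ)
    (hα₁ : Integrable α₁ μ) (hα₂ : Integrable α₂ μ) (hβ : Integrable β μ)
    (hγ₁ : Integrable γ₁ μ) (hγ₂ : Integrable γ₂ μ)
    (hα₁β : Integrable (fun x => α₁ x * β x) μ)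
    (hα₁γ₁ : Integrable (fun x => α₁ x * γ₁ x) μ)
    (hα₂β : Integrable (fun x => α₂ x * β x) μ)
    (hα₂γ₂ : Integrable (fun x => α₂ x * γ₂ x) μ)
    (hcov₁β : ∫ x, α₁ x * β x ∂μ - (∫ x, α₁ x ∂μ) * (∫ x, β x ∂μ) = 0)
    (hcov₁γ : ∫ x, α₁ x * γ₁ x ∂μ - (∫ x, α₁ x ∂μ) * (∫ x, γ₁ x ∂μ) = 0)
    (hcov₂β : ∫ x, α₂ x * β x ∂μ - (∫ x, α₂ x ∂μ) * (∫ x, β x ∂μ) = 0)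
    (hcov₂γ : ∫ x, α₂ x * γ₂ x ∂μ - (∫ x, α₂ x ∂μ) * (∫ x, γ₂ x ∂μ) = 0)
    (hγ₁0 : ∫ x, γ₁ x ∂μ = 0) (hγ₂0 : ∫ x, γ₂ x ∂μ = 0)
    (hα₁ne : ∫ x, α₁ x ∂μ ≠ 0) (hβne : ∫ x, β x ∂μ ≠ 0) :
    ∀ t₁ t₂ : ℝ,
      (∫ x, α₂ x * (β x + γ₂ x * t₂) ∂μ) / (∫ x, α₁ x * (β x + γ₁ x * t₁) ∂μ)
        = (∫ x, α₂ x ∂μ) / (∫ x, α₁ x ∂μ) := by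
  have key : ∀ (a b g : Ω → ℝ) (t : ℝ), Integrable (fun x => a x * b x) μ →
      Integrable (fun x => a x * g x) μ →
      ∫ x, a x * (b x + g x * t) ∂μ = ∫ x, a x * b x ∂μ + (∫ x, a x * g x ∂μ) * t := by
    intro a b g t hab hag
    rw [← integral_mul_const, ← integral_add hab (hag.mul_const t)]
    congr 1
    funext x
    ring
  intro t₁ t₂
  rw [key α₂ β γ₂ t₂ hα₂β hα₂γ₂, key α₁ β γ₁ t₁ hα₁β hα₁γ₁, sub_eq_zero.mp hcov₁β,
    sub_eq_zero.mp hcov₁γ, sub_eq_zero.mp hcov₂β, sub_eq_zero.mp hcov₂γ, hγ₁0, hγ₂0]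
  simp only [mul_zero, zero_mul, add_zero]
  exact mul_div_mul_right _ _ hβne
end

section
/- Let α₁, α₂, β, γ₁, γ₂ be integrable real random variables on a probability space with α₁·β, α₁·γ₁, α₂·β, α₂·γ₂ integrable, and let τ₁, τ₂ be nonzero real numbers. Assume Cov(α₁, β) = 0, Cov(α₁, γ₁) = 0, Cov(α₂, β) = 0, Cov(α₂, γ₂) = 0, E[γ₁] = E[γ₂] = 0, E[α₁] ≠ 0, and E[β] ≠ 0. Then for all reals t₁, t₂: (E[α₂·(β + γ₂·t₂)] / τ₂) / (E[α₁·(β + γ₁·t₁)] / τ₁) = (E[α₂]·τ₁) / (E[α₁]·τ₂). -/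
open MeasureTheory

/-- Identification of the second comparative causal mediation estimand:
`(κ₂(t₂)/τ₂)/(κ₁(t₁)/τ₁) = (E[α₂]·τ₁)/(E[α₁]·τ₂)`. -/
theorem ccm_estimand_two_identification
    {Ω : Type*} [MeasurableSpace Ω] (μ : Measure Ω) [IsProbabilityMeasure μ]
    (α₁ α₂ β γ₁ γ₂ : Ω → ℝ) (τ₁ τ₂ : ℝ)
    (hτ₁ : τ₁ ≠ 0) (hτ₂ : τ₂ ≠ 0)
    (hα₁ : Integrable α₁ μ) (hα₂ : Integrable α₂ μ) (hβ : Integrable β μ)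
    (hγ₁ : Integrable γ₁ μ) (hγ₂ : Integrable γ₂ μ)
    (hα₁β : Integrable (fun x => α₁ x * β x) μ)
    (hα₁γ₁ : Integrable (fun x => α₁ x * γ₁ x) μ)
    (hα₂β : Integrable (fun x => α₂ x * β x) μ)
    (hα₂γ₂ : Integrable (fun x => α₂ x * γ₂ x) μ)
    (hcov₁β : ∫ x, α₁ x * β x ∂μ - (∫ x, α₁ x ∂μ) * (∫ x, β x ∂μ) = 0)
    (hcov₁γ : ∫ x, α₁ x * γ₁ x ∂μ - (∫ x, α₁ x ∂μ) * (∫ x, γ₁ x ∂μ) = 0)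
    (hcov₂β : ∫ x, α₂ x * β x ∂μ - (∫ x, α₂ x ∂μ) * (∫ x, β x ∂μ) = 0)
    (hcov₂γ : ∫ x, α₂ x * γ₂ x ∂μ - (∫ x, α₂ x ∂μ) * (∫ x, γ₂ x ∂μ) = 0)
    (hγ₁0 : ∫ x, γ₁ x ∂μ = 0) (hγ₂0 : ∫ x, γ₂ x ∂μ = 0)
    (hα₁ne : ∫ x, α₁ x ∂μ ≠ 0) (hβne : ∫ x, β x ∂μ ≠ 0) :
    ∀ t₁ t₂ : ℝ,
      ((∫ x, α₂ x * (β x + γ₂ x * t₂) ∂μ) / τ₂) / ((∫ x, α₁ x * (β x + γ₁ x * t₁) ∂μ) / τ₁)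
        = ((∫ x, α₂ x ∂μ) * τ₁) / ((∫ x, α₁ x ∂μ) * τ₂) := by
  intro t₁ t₂
  have key : ∀ (a g : Ω → ℝ) (t : ℝ), Integrable (fun x => a x * β x) μ →
      Integrable (fun x => a x * g x) μ →
      ∫ x, a x * (β x + g x * t) ∂μ = ∫ x, a x * β x ∂μ + (∫ x, a x * g x ∂μ) * t := by
    intro a g t h1 h2
    rw [← integral_mul_const, ← integral_add h1 (h2.mul_const t)]
    congr 1
    ext x
    ring
  rw [key α₂ γ₂ t₂ hα₂β hα₂γ₂, key α₁ γ₁ t₁ hα₁β hα₁γ₁, sub_eq_zero.mp hcov₁β,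
    sub_eq_zero.mp hcov₁γ, sub_eq_zero.mp hcov₂β, sub_eq_zero.mp hcov₂γ, hγ₁0, hγ₂0]
  simp only [mul_zero, zero_mul, add_zero]
  field_simp
end

section
/- (Proposition 1, first estimand.) Let α₁, α₂, β, γ₁, γ₂ be integrable real random variables on a probability space with α₁·β, α₁·γ₁, α₂·β, α₂·γ₂ integrable, satisfying Cov(α₁, β) = 0, Cov(α₁, γ₁) = 0, Cov(α₂, β) = 0, Cov(α₂, γ₂) = 0, E[γ₁] = E[γ₂] = 0, E[α₁] ≠ 0, and E[β] ≠ 0. Define κ_j(t_j) = E[α_j·(β + γ_j·t_j)] for j = 1, 2. Let (Â₁ᴺ), (Â₂ᴺ), (B̂ᴺ) be sequences of real random variables such that Â₁ᴺ → E[α₁], Â₂ᴺ → E[α₂], and B̂ᴺ → b in probability for some real b ≠ 0. Then for all reals t₁, t₂, the estimator (Â₂ᴺ·B̂ᴺ)/(Â₁ᴺ·B̂ᴺ) converges in probability to κ₂(t₂)/κ₁(t₁) = E[α₂]/E[α₁]. -/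
open MeasureTheory Filter

/-- Proposition 1, first estimand: the estimator `(Â₂ᴺ·B̂ᴺ)/(Â₁ᴺ·B̂ᴺ)` converges in
probability to `κ₂(t₂)/κ₁(t₁) = E[α₂]/E[α₁]`, even though `B̂ᴺ` may converge to a
confounding-biased limit `b ≠ E[β]`. -/
theorem ccm_proposition_one_first_estimand
    {Ω : Type*} [MeasurableSpace Ω] (μ : Measure Ω) [IsProbabilityMeasure μ]
    (α₁ α₂ β γ₁ γ₂ : Ω → ℝ)
    (hα₁ : Integrable α₁ μ) (hα₂ : Integrable α₂ μ) (hβ : Integrable β μ)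
    (hγ₁ : Integrable γ₁ μ) (hγ₂ : Integrable γ₂ μ)
    (hα₁β : Integrable (fun x => α₁ x * β x) μ)
    (hα₁γ₁ : Integrable (fun x => α₁ x * γ₁ x) μ)
    (hα₂β : Integrable (fun x => α₂ x * β x) μ)
    (hα₂γ₂ : Integrable (fun x => α₂ x * γ₂ x) μ)
    (hcov₁β : ∫ x, α₁ x * β x ∂μ - (∫ x, α₁ x ∂μ) * (∫ x, β x ∂μ) = 0)
    (hcov₁γ : ∫ x, α₁ x * γ₁ x ∂μ - (∫ x, α₁ x ∂μ) * (∫ x, γ₁ x ∂μ) = 0)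
    (hcov₂β : ∫ x, α₂ x * β x ∂μ - (∫ x, α₂ x ∂μ) * (∫ x, β x ∂μ) = 0)
    (hcov₂γ : ∫ x, α₂ x * γ₂ x ∂μ - (∫ x, α₂ x ∂μ) * (∫ x, γ₂ x ∂μ) = 0)
    (hγ₁0 : ∫ x, γ₁ x ∂μ = 0) (hγ₂0 : ∫ x, γ₂ x ∂μ = 0)
    (hα₁ne : ∫ x, α₁ x ∂μ ≠ 0) (hβne : ∫ x, β x ∂μ ≠ 0)
    (A₁ A₂ B : ℕ → Ω → ℝ) (b : ℝ) (hb : b ≠ 0)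
    (hA₁ : TendstoInMeasure μ A₁ atTop (fun _ => ∫ x, α₁ x ∂μ))
    (hA₂ : TendstoInMeasure μ A₂ atTop (fun _ => ∫ x, α₂ x ∂μ))
    (hB : TendstoInMeasure μ B atTop (fun _ => b)) :
    ∀ t₁ t₂ : ℝ,
      TendstoInMeasure μ (fun N x => (A₂ N x * B N x) / (A₁ N x * B N x)) atTop
        (fun _ => (∫ x, α₂ x * (β x + γ₂ x * t₂) ∂μ)
          / (∫ x, α₁ x * (β x + γ₁ x * t₁) ∂μ)) ∧
      (∫ x, α₂ x * (β x + γ₂ x * t₂) ∂μ) / (∫ x, α₁ x * (β x + γ₁ x * t₁) ∂μ)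
        = (∫ x, α₂ x ∂μ) / (∫ x, α₁ x ∂μ) := by
  intro t₁ t₂
  have key : ∀ (a g : Ω → ℝ) (t : ℝ), Integrable (fun x => a x * β x) μ →
      Integrable (fun x => a x * g x) μ →
      ∫ x, a x * β x ∂μ - (∫ x, a x ∂μ) * (∫ x, β x ∂μ) = 0 →
      ∫ x, a x * g x ∂μ - (∫ x, a x ∂μ) * (∫ x, g x ∂μ) = 0 →
      ∫ x, g x ∂μ = 0 →
      ∫ x, a x * (β x + g x * t) ∂μ = (∫ x, a x ∂μ) * (∫ x, β x ∂μ) := by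
    intro a g t h1 h2 h3 h4 h5
    have e : (fun x => a x * (β x + g x * t)) = fun x => a x * β x + (a x * g x) * t := by
      funext x; ring
    rw [e, integral_add h1 (h2.mul_const t), integral_mul_const]
    rw [h5] at h4
    have h6 : ∫ x, a x * g x ∂μ = 0 := by linarith
    rw [h6]; linarith
  have hratio : (∫ x, α₂ x * (β x + γ₂ x * t₂) ∂μ) / (∫ x, α₁ x * (β x + γ₁ x * t₁) ∂μ)
        = (∫ x, α₂ x ∂μ) / (∫ x, α₁ x ∂μ) := by
    rw [key α₁ γ₁ t₁ hα₁β hα₁γ₁ hcov₁β hcov₁γ hγ₁0, key α₂ γ₂ t₂ hα₂β hα₂γ₂ hcov₂β hcov₂γ hγ₂0]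
    exact mul_div_mul_right _ _ hβne
  refine ⟨?_, hratio⟩
  rw [hratio]
  generalize (∫ x, α₁ x ∂μ) = a₁ at *
  generalize (∫ x, α₂ x ∂μ) = a₂ at *
  rw [tendstoInMeasure_iff_dist] at hA₁ hA₂ hB ⊢
  intro ε hε
  have hc : ContinuousAt (fun p : ℝ × ℝ × ℝ => (p.2.1 * p.2.2) / (p.1 * p.2.2)) (a₁, a₂, b) := by
    apply ContinuousAt.div
    · fun_prop
    · fun_prop
    · exact mul_ne_zero hα₁ne hb
  obtain ⟨δ, hδ, h⟩ := Metric.continuousAt_iff.1 hc ε hε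
  have hsum := ((hA₁ δ hδ).add (hA₂ δ hδ)).add (hB δ hδ)
  simp only [add_zero] at hsum
  refine tendsto_of_tendsto_of_tendsto_of_le_of_le tendsto_const_nhds hsum
    (fun _ => zero_le) (fun N => ?_)
  refine le_trans (measure_mono ?_)
    ((measure_union_le _ _).trans (add_le_add_left (measure_union_le _ _) _))
  intro x hx
  by_contra hn
  simp only [Set.mem_union, Set.mem_setOf_eq, not_or, not_le] at hn hx
  have h' := @h (A₁ N x, A₂ N x, B N x) (by
    simp only [Prod.dist_eq, max_lt_iff]
    exact ⟨hn.1.1, hn.1.2, hn.2⟩)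
  simp only [mul_div_mul_right a₂ a₁ hb] at h'
  exact absurd hx (not_le.2 h')
end

section
/- (Proposition 1, second estimand.) Let α₁, α₂, β, γ₁, γ₂ be integrable real random variables on a probability space with α₁·β, α₁·γ₁, α₂·β, α₂·γ₂ integrable, satisfying Cov(α₁, β) = 0, Cov(α₁, γ₁) = 0, Cov(α₂, β) = 0, Cov(α₂, γ₂) = 0, E[γ₁] = E[γ₂] = 0, E[α₁] ≠ 0, and E[β] ≠ 0. Let τ₁, τ₂ be nonzero real numbers and define κ_j(t_j) = E[α_j·(β + γ_j·t_j)]. Let (Â₁ᴺ), (Â₂ᴺ), (B̂ᴺ), (τ̂₁ᴺ), (τ̂₂ᴺ) be sequences of real random variables with Â₁ᴺ → E[α₁], Â₂ᴺ → E[α₂], τ̂₁ᴺ → τ₁, τ̂₂ᴺ → τ₂ in probability, and B̂ᴺ → b in probability for some real b ≠ 0. Then for all reals t₁, t₂, the estimator ((Â₂ᴺ·B̂ᴺ)/τ̂₂ᴺ) / ((Â₁ᴺ·B̂ᴺ)/τ̂₁ᴺ) converges in probability to (κ₂(t₂)/τ₂)/(κ₁(t₁)/τ₁) = (E[α₂]·τ₁)/(E[α₁]·τ₂).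 -/
open MeasureTheory Filter

lemma ccm_cmt_two {Ω : Type*} [MeasurableSpace Ω] (μ : Measure Ω)
    (X Y : ℕ → Ω → ℝ) (a b : ℝ) (F : ℝ × ℝ → ℝ) (hF : ContinuousAt F (a, b))
    (hX : TendstoInMeasure μ X atTop (fun _ => a))
    (hY : TendstoInMeasure μ Y atTop (fun _ => b)) :
    TendstoInMeasure μ (fun N x => F (X N x, Y N x)) atTop (fun _ => F (a, b)) := by
  rw [tendstoInMeasure_iff_dist] at *
  intro ε hε
  obtain ⟨δ, hδ, h⟩ := Metric.continuousAt_iff.1 hF ε hε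
  have hs := (hX δ hδ).add (hY δ hδ)
  rw [add_zero] at hs
  refine tendsto_of_tendsto_of_tendsto_of_le_of_le tendsto_const_nhds hs
    (fun _ => zero_le) (fun N => ?_)
  refine (measure_mono ?_).trans (measure_union_le _ _)
  intro x hx
  by_contra hc
  simp only [Set.mem_union, Set.mem_setOf_eq, not_or, not_le] at hc hx
  have h2 : dist (X N x, Y N x) (a, b) < δ := by
    rw [Prod.dist_eq]
    exact max_lt hc.1 hc.2
  exact absurd (h h2) (not_lt.2 hx)

lemma ccm_acme {Ω : Type*} [MeasurableSpace Ω] (μ : Measure Ω) (α β γ : Ω → ℝ) (t : ℝ)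
    (hαβ : Integrable (fun x => α x * β x) μ) (hαγ : Integrable (fun x => α x * γ x) μ)
    (h1 : ∫ x, α x * β x ∂μ - (∫ x, α x ∂μ) * (∫ x, β x ∂μ) = 0)
    (h2 : ∫ x, α x * γ x ∂μ - (∫ x, α x ∂μ) * (∫ x, γ x ∂μ) = 0)
    (h0 : ∫ x, γ x ∂μ = 0) :
    ∫ x, α x * (β x + γ x * t) ∂μ = (∫ x, α x ∂μ) * (∫ x, β x ∂μ) := by
  have e : (fun x => α x * (β x + γ x * t)) = fun x => α x * β x + (α x * γ x) * t := by
    funext x; ring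
  rw [e, integral_add hαβ (hαγ.mul_const t), integral_mul_const]
  rw [h0] at h2
  linear_combination h1 + t * h2

/-- Proposition 1, second estimand: `((Â₂ᴺ·B̂ᴺ)/τ̂₂ᴺ)/((Â₁ᴺ·B̂ᴺ)/τ̂₁ᴺ)` converges in
probability to `(κ₂(t₂)/τ₂)/(κ₁(t₁)/τ₁) = (E[α₂]·τ₁)/(E[α₁]·τ₂)`. -/
theorem ccm_proposition_one_second_estimand
    {Ω : Type*} [MeasurableSpace Ω] (μ : Measure Ω) [IsProbabilityMeasure μ]
    (α₁ α₂ β γ₁ γ₂ : Ω → ℝ) (τ₁ τ₂ : ℝ) (hτ₁ : τ₁ ≠ 0) (hτ₂ : τ₂ ≠ 0)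
    (hα₁ : Integrable α₁ μ) (hα₂ : Integrable α₂ μ) (hβ : Integrable β μ)
    (hγ₁ : Integrable γ₁ μ) (hγ₂ : Integrable γ₂ μ)
    (hα₁β : Integrable (fun x => α₁ x * β x) μ)
    (hα₁γ₁ : Integrable (fun x => α₁ x * γ₁ x) μ)
    (hα₂β : Integrable (fun x => α₂ x * β x) μ)
    (hα₂γ₂ : Integrable (fun x => α₂ x * γ₂ x) μ)
    (hcov₁β : ∫ x, α₁ x * β x ∂μ - (∫ x, α₁ x ∂μ) * (∫ x, β x ∂μ) = 0)
    (hcov₁γ : ∫ x, α₁ x * γ₁ x ∂μ - (∫ x, α₁ x ∂μ) * (∫ x, γ₁ x ∂μ) = 0)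
    (hcov₂β : ∫ x, α₂ x * β x ∂μ - (∫ x, α₂ x ∂μ) * (∫ x, β x ∂μ) = 0)
    (hcov₂γ : ∫ x, α₂ x * γ₂ x ∂μ - (∫ x, α₂ x ∂μ) * (∫ x, γ₂ x ∂μ) = 0)
    (hγ₁0 : ∫ x, γ₁ x ∂μ = 0) (hγ₂0 : ∫ x, γ₂ x ∂μ = 0)
    (hα₁ne : ∫ x, α₁ x ∂μ ≠ 0) (hβne : ∫ x, β x ∂μ ≠ 0)
    (A₁ A₂ B τh₁ τh₂ : ℕ → Ω → ℝ) (b : ℝ) (hb : b ≠ 0)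
    (hA₁ : TendstoInMeasure μ A₁ atTop (fun _ => ∫ x, α₁ x ∂μ))
    (hA₂ : TendstoInMeasure μ A₂ atTop (fun _ => ∫ x, α₂ x ∂μ))
    (hτh₁ : TendstoInMeasure μ τh₁ atTop (fun _ => τ₁))
    (hτh₂ : TendstoInMeasure μ τh₂ atTop (fun _ => τ₂))
    (hB : TendstoInMeasure μ B atTop (fun _ => b)) :
    ∀ t₁ t₂ : ℝ,
      TendstoInMeasure μ
        (fun N x => ((A₂ N x * B N x) / τh₂ N x) / ((A₁ N x * B N x) / τh₁ N x)) atTop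
        (fun _ => ((∫ x, α₂ x * (β x + γ₂ x * t₂) ∂μ) / τ₂)
          / ((∫ x, α₁ x * (β x + γ₁ x * t₁) ∂μ) / τ₁)) ∧
      ((∫ x, α₂ x * (β x + γ₂ x * t₂) ∂μ) / τ₂)
          / ((∫ x, α₁ x * (β x + γ₁ x * t₁) ∂μ) / τ₁)
        = ((∫ x, α₂ x ∂μ) * τ₁) / ((∫ x, α₁ x ∂μ) * τ₂) := by
  intro t₁ t₂
  have key : ((∫ x, α₂ x * (β x + γ₂ x * t₂) ∂μ) / τ₂)
          / ((∫ x, α₁ x * (β x + γ₁ x * t₁) ∂μ) / τ₁)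
        = ((∫ x, α₂ x ∂μ) * τ₁) / ((∫ x, α₁ x ∂μ) * τ₂) := by
    rw [ccm_acme μ α₂ β γ₂ t₂ hα₂β hα₂γ₂ hcov₂β hcov₂γ hγ₂0,
      ccm_acme μ α₁ β γ₁ t₁ hα₁β hα₁γ₁ hcov₁β hcov₁γ hγ₁0]
    field_simp
  refine ⟨?_, key⟩
  rw [key]
  have hmul : ∀ p : ℝ × ℝ, ContinuousAt (fun q : ℝ × ℝ => q.1 * q.2) p :=
    fun p => continuousAt_fst.mul continuousAt_snd
  have hdiv : ∀ u v : ℝ, v ≠ 0 → ContinuousAt (fun q : ℝ × ℝ => q.1 / q.2) (u, v) :=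
    fun u v hv => continuousAt_fst.div continuousAt_snd hv
  have n2 := ccm_cmt_two μ _ _ _ _ _ (hmul _) hA₂ hB
  have n1 := ccm_cmt_two μ _ _ _ _ _ (hmul _) hA₁ hB
  have q2 := ccm_cmt_two μ _ _ _ _ _ (hdiv _ _ hτ₂) n2 hτh₂
  have q1 := ccm_cmt_two μ _ _ _ _ _ (hdiv _ _ hτ₁) n1 hτh₁
  have r := ccm_cmt_two μ _ _ _ _ _
    (hdiv _ _ (div_ne_zero (mul_ne_zero hα₁ne hb) hτ₁)) q2 q1
  have e : ((∫ x, α₂ x ∂μ) * b / τ₂) / ((∫ x, α₁ x ∂μ) * b / τ₁)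
      = ((∫ x, α₂ x ∂μ) * τ₁) / ((∫ x, α₁ x ∂μ) * τ₂) := by
    field_simp
  rw [← e]
  exact r
end

section
/- (Proposition 2, first estimand.) Let α₁, α₂, β, γ₁, γ₂ be integrable real random variables on a probability space with α₁·β, α₁·γ₁, α₂·β, α₂·γ₂ integrable, satisfying Cov(α₁, β) = 0, Cov(α₁, γ₁) = 0, Cov(α₂, β) = 0, Cov(α₂, γ₂) = 0. Write ω_j = E[β] + E[γ_j] and define κ_j(1) = E[α_j·(β + γ_j)], so κ_j(1) = E[α_j]·ω_j. Let ξ₁, ξ₂ be real numbers (asymptotic biases) with ω₁ > 0, ω₂ > 0, ω₁ + ξ₁ > 0, E[α₁] > 0, E[α₂] > 0, and ω₂·ξ₁ > ω₁·ξ₂. Let (Â₁ᴺ), (Â₂ᴺ), (Ŵ₁ᴺ), (Ŵ₂ᴺ) be sequences of real random variables with Â₁ᴺ → E[α₁], Â₂ᴺ → E[α₂], Ŵ₁ᴺ → ω₁ + ξ₁, Ŵ₂ᴺ → ω₂ + ξ₂ in probability. Then the estimator (Â₂ᴺ·Ŵ₂ᴺ)/(Â₁ᴺ·Ŵ₁ᴺ)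 converges in probability to the constant (E[α₂]·(ω₂ + ξ₂))/(E[α₁]·(ω₁ + ξ₁)), and this limit is strictly less than κ₂(1)/κ₁(1) = (E[α₂]·ω₂)/(E[α₁]·ω₁). -/
open MeasureTheory Filter

/-- Continuous mapping for convergence in measure to constants, in two variables. -/
theorem tendstoInMeasure_map_two {Ω : Type*} [MeasurableSpace Ω] {μ : Measure Ω}
    {X Y : ℕ → Ω → ℝ} {a b : ℝ} (F : ℝ × ℝ → ℝ) (hF : ContinuousAt F (a, b))
    (hX : TendstoInMeasure μ X atTop (fun _ => a))
    (hY : TendstoInMeasure μ Y atTop (fun _ => b)) :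
    TendstoInMeasure μ (fun N x => F (X N x, Y N x)) atTop (fun _ => F (a, b)) := by
  rw [tendstoInMeasure_iff_dist] at hX hY ⊢
  intro ε hε
  obtain ⟨δ, hδ, h⟩ := Metric.continuousAt_iff.1 hF ε hε
  have hsum := (hX δ hδ).add (hY δ hδ)
  rw [add_zero] at hsum
  refine tendsto_of_tendsto_of_tendsto_of_le_of_le tendsto_const_nhds hsum
    (fun _ => zero_le) (fun N => ?_)
  refine le_trans (measure_mono ?_) (measure_union_le _ _)
  intro x hx
  by_contra hcon
  simp only [Set.mem_union, Set.mem_setOf_eq, not_or, not_le] at hcon hx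
  have hd : dist (X N x, Y N x) (a, b) < δ := by
    rw [Prod.dist_eq]
    exact max_lt hcon.1 hcon.2
  exact absurd (h hd) (not_lt.2 hx)

/-- Proposition 2, first estimand: with treatment–mediator interactions and
confounding biases `ξ₁, ξ₂` satisfying `ω₂·ξ₁ > ω₁·ξ₂`, the estimator
`(Â₂ᴺ·Ŵ₂ᴺ)/(Â₁ᴺ·Ŵ₁ᴺ)` converges in probability to
`(E[α₂]·(ω₂+ξ₂))/(E[α₁]·(ω₁+ξ₁))`, which is strictly less than
`κ₂(1)/κ₁(1) = (E[α₂]·ω₂)/(E[α₁]·ω₁)`. -/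
theorem ccm_proposition_two_first_estimand
    {Ω : Type*} [MeasurableSpace Ω] (μ : Measure Ω) [IsProbabilityMeasure μ]
    (α₁ α₂ β γ₁ γ₂ : Ω → ℝ)
    (hα₁ : Integrable α₁ μ) (hα₂ : Integrable α₂ μ) (hβ : Integrable β μ)
    (hγ₁ : Integrable γ₁ μ) (hγ₂ : Integrable γ₂ μ)
    (hα₁β : Integrable (fun x => α₁ x * β x) μ)
    (hα₁γ₁ : Integrable (fun x => α₁ x * γ₁ x) μ)
    (hα₂β : Integrable (fun x => α₂ x * β x) μ)
    (hα₂γ₂ : Integrable (fun x => α₂ x * γ₂ x) μ)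
    (hcov₁β : ∫ x, α₁ x * β x ∂μ - (∫ x, α₁ x ∂μ) * (∫ x, β x ∂μ) = 0)
    (hcov₁γ : ∫ x, α₁ x * γ₁ x ∂μ - (∫ x, α₁ x ∂μ) * (∫ x, γ₁ x ∂μ) = 0)
    (hcov₂β : ∫ x, α₂ x * β x ∂μ - (∫ x, α₂ x ∂μ) * (∫ x, β x ∂μ) = 0)
    (hcov₂γ : ∫ x, α₂ x * γ₂ x ∂μ - (∫ x, α₂ x ∂μ) * (∫ x, γ₂ x ∂μ) = 0)
    (ξ₁ ξ₂ : ℝ)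
    (hω₁pos : 0 < (∫ x, β x ∂μ) + (∫ x, γ₁ x ∂μ))
    (hω₂pos : 0 < (∫ x, β x ∂μ) + (∫ x, γ₂ x ∂μ))
    (hω₁ξpos : 0 < ((∫ x, β x ∂μ) + (∫ x, γ₁ x ∂μ)) + ξ₁)
    (hα₁pos : 0 < ∫ x, α₁ x ∂μ) (hα₂pos : 0 < ∫ x, α₂ x ∂μ)
    (hcond : ((∫ x, β x ∂μ) + (∫ x, γ₂ x ∂μ)) * ξ₁
      > ((∫ x, β x ∂μ) + (∫ x, γ₁ x ∂μ)) * ξ₂)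
    (A₁ A₂ W₁ W₂ : ℕ → Ω → ℝ)
    (hA₁ : TendstoInMeasure μ A₁ atTop (fun _ => ∫ x, α₁ x ∂μ))
    (hA₂ : TendstoInMeasure μ A₂ atTop (fun _ => ∫ x, α₂ x ∂μ))
    (hW₁ : TendstoInMeasure μ W₁ atTop
      (fun _ => ((∫ x, β x ∂μ) + (∫ x, γ₁ x ∂μ)) + ξ₁))
    (hW₂ : TendstoInMeasure μ W₂ atTop
      (fun _ => ((∫ x, β x ∂μ) + (∫ x, γ₂ x ∂μ)) + ξ₂)) :
    TendstoInMeasure μ (fun N x => (A₂ N x * W₂ N x) / (A₁ N x * W₁ N x)) atTop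
      (fun _ => ((∫ x, α₂ x ∂μ) * (((∫ x, β x ∂μ) + (∫ x, γ₂ x ∂μ)) + ξ₂))
        / ((∫ x, α₁ x ∂μ) * (((∫ x, β x ∂μ) + (∫ x, γ₁ x ∂μ)) + ξ₁))) ∧
    ((∫ x, α₂ x ∂μ) * (((∫ x, β x ∂μ) + (∫ x, γ₂ x ∂μ)) + ξ₂))
        / ((∫ x, α₁ x ∂μ) * (((∫ x, β x ∂μ) + (∫ x, γ₁ x ∂μ)) + ξ₁))
      < (∫ x, α₂ x * (β x + γ₂ x) ∂μ) / (∫ x, α₁ x * (β x + γ₁ x) ∂μ) ∧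
    (∫ x, α₂ x * (β x + γ₂ x) ∂μ) / (∫ x, α₁ x * (β x + γ₁ x) ∂μ)
      = ((∫ x, α₂ x ∂μ) * ((∫ x, β x ∂μ) + (∫ x, γ₂ x ∂μ)))
        / ((∫ x, α₁ x ∂μ) * ((∫ x, β x ∂μ) + (∫ x, γ₁ x ∂μ))) := by
  have hk : ∀ a c : Ω → ℝ, Integrable (fun x => a x * β x) μ →
      Integrable (fun x => a x * c x) μ →
      ∫ x, a x * β x ∂μ - (∫ x, a x ∂μ) * (∫ x, β x ∂μ) = 0 →
      ∫ x, a x * c x ∂μ - (∫ x, a x ∂μ) * (∫ x, c x ∂μ) = 0 →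
      ∫ x, a x * (β x + c x) ∂μ = (∫ x, a x ∂μ) * ((∫ x, β x ∂μ) + (∫ x, c x ∂μ)) := by
    intro a c h1 h2 h3 h4
    simp only [mul_add]
    rw [integral_add h1 h2]
    linarith
  rw [hk α₁ γ₁ hα₁β hα₁γ₁ hcov₁β hcov₁γ, hk α₂ γ₂ hα₂β hα₂γ₂ hcov₂β hcov₂γ]
  refine ⟨?_, ?_, rfl⟩
  · have hn := tendstoInMeasure_map_two (fun p => p.1 * p.2) (by fun_prop) hA₂ hW₂
    have hd := tendstoInMeasure_map_two (fun p => p.1 * p.2) (by fun_prop) hA₁ hW₁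
    have hne := (mul_pos hα₁pos hω₁ξpos).ne'
    exact tendstoInMeasure_map_two (fun p => p.1 / p.2)
      (ContinuousAt.div continuousAt_fst continuousAt_snd hne) hn hd
  · rw [div_lt_div_iff₀ (mul_pos hα₁pos hω₁ξpos) (mul_pos hα₁pos hω₁pos)]
    have h := mul_lt_mul_of_pos_left hcond (mul_pos hα₂pos hα₁pos)
    linarith
end

section
/- Let α₁, α₂, β, γ₁, γ₂ be integrable real random variables on a probability space with α₁·β, α₁·γ₁, α₂·β, α₂·γ₂ integrable. If Cov(α₁, β) = 0, Cov(α₁, γ₁) = 0, Cov(α₂, β) = 0, Cov(α₂, γ₂) = 0, E[α₁] ≠ 0, and E[β] + E[γ₁] ≠ 0, then E[α₂·(β + γ₂)] / E[α₁·(β + γ₁)] = (E[α₂]·(E[β] + E[γ₂])) / (E[α₁]·(E[β] + E[γ₁])). -/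
open MeasureTheory

/-- Identification step of Proposition 2: under the no-covariance assumption,
`κ₂(1)/κ₁(1) = E[α₂·(β + γ₂)]/E[α₁·(β + γ₁)]` equals
`(E[α₂]·(E[β] + E[γ₂]))/(E[α₁]·(E[β] + E[γ₁]))`. -/
theorem ccm_estimand_one_identification_with_interactions
    {Ω : Type*} [MeasurableSpace Ω] (μ : Measure Ω) [IsProbabilityMeasure μ]
    (α₁ α₂ β γ₁ γ₂ : Ω → ℝ)
    (hα₁ : Integrable α₁ μ) (hα₂ : Integrable α₂ μ) (hβ : Integrable β μ)
    (hγ₁ : Integrable γ₁ μ) (hγ₂ : Integrable γ₂ μ)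
    (hα₁β : Integrable (fun x => α₁ x * β x) μ)
    (hα₁γ₁ : Integrable (fun x => α₁ x * γ₁ x) μ)
    (hα₂β : Integrable (fun x => α₂ x * β x) μ)
    (hα₂γ₂ : Integrable (fun x => α₂ x * γ₂ x) μ)
    (hcov₁β : ∫ x, α₁ x * β x ∂μ - (∫ x, α₁ x ∂μ) * (∫ x, β x ∂μ) = 0)
    (hcov₁γ : ∫ x, α₁ x * γ₁ x ∂μ - (∫ x, α₁ x ∂μ) * (∫ x, γ₁ x ∂μ) = 0)
    (hcov₂β : ∫ x, α₂ x * β x ∂μ - (∫ x, α₂ x ∂μ) * (∫ x, β x ∂μ) = 0)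
    (hcov₂γ : ∫ x, α₂ x * γ₂ x ∂μ - (∫ x, α₂ x ∂μ) * (∫ x, γ₂ x ∂μ) = 0)
    (hα₁ne : ∫ x, α₁ x ∂μ ≠ 0)
    (hω₁ne : (∫ x, β x ∂μ) + (∫ x, γ₁ x ∂μ) ≠ 0) :
    (∫ x, α₂ x * (β x + γ₂ x) ∂μ) / (∫ x, α₁ x * (β x + γ₁ x) ∂μ)
      = ((∫ x, α₂ x ∂μ) * ((∫ x, β x ∂μ) + (∫ x, γ₂ x ∂μ)))
        / ((∫ x, α₁ x ∂μ) * ((∫ x, β x ∂μ) + (∫ x, γ₁ x ∂μ))) := by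
  have h₁ : ∫ x, α₁ x * (β x + γ₁ x) ∂μ
      = (∫ x, α₁ x ∂μ) * ((∫ x, β x ∂μ) + (∫ x, γ₁ x ∂μ)) := by
    simp only [mul_add]
    rw [integral_add hα₁β hα₁γ₁, sub_eq_zero.mp hcov₁β, sub_eq_zero.mp hcov₁γ]
  have h₂ : ∫ x, α₂ x * (β x + γ₂ x) ∂μ
      = (∫ x, α₂ x ∂μ) * ((∫ x, β x ∂μ) + (∫ x, γ₂ x ∂μ)) := by
    simp only [mul_add]
    rw [integral_add hα₂β hα₂γ₂, sub_eq_zero.mp hcov₂β, sub_eq_zero.mp hcov₂γ]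
  rw [h₁, h₂]
end
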